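/- arXiv:2206.00548 — 3 statements merged into one kernel-verified Lean document; each statement's English description precedes it below -/
import Mathlib

section
/- Let P be a standard parabolic submonoid of M satisfying Assumption 1 and let g be a P-ribbon. Write H(g) = leftgcd(g, Δ) and define T(g) by g = H(g) T(g). Then H(g) is a P-ribbon and T(g) is a P^{H(g)}-ribbon. Consequently, all the terms of the Garside normal form of g are ribbons (each term gᵢ being a ribbon for the successive conjugate of P). -/
/-!
Common setting: Garside monoids, standard parabolic submonoids, heads,
ribbons, following Digne–Michel, "Ribbons in Garside monoids".
-/

namespace GarsidePaper

variable {M : Type*}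

/-- `a` left-divides `b` : `b = a * c` for some `c`. -/
def LDvd [Monoid M] (a b : M) : Prop := ∃ c, b = a * c

/-- `a` right-divides `b` : `b = c * a` for some `c`. -/
def RDvd [Monoid M] (a b : M) : Prop := ∃ c, b = c * a

/-- `a` is a factor of `b` : `a` left-divides a right-divisor of `b`. -/
def IsFactor [Monoid M] (a b : M) : Prop := ∃ c, LDvd a c ∧ RDvd c b

/-- A Garside structure on a (left- and right-) cancellative monoid `M`:
left/right gcds and lcms, Noetherianity, and a Garside element `Δ`. -/
structure GarsideStruct (M : Type*) [CancelMonoid M] where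
  /-- left-gcd : gcd for the left-divisibility order -/
  lgcd : M → M → M
  lgcd_dvd_left : ∀ a b, LDvd (lgcd a b) a
  lgcd_dvd_right : ∀ a b, LDvd (lgcd a b) b
  lgcd_greatest : ∀ a b d, LDvd d a → LDvd d b → LDvd d (lgcd a b)
  /-- right-lcm : lcm for the left-divisibility order -/
  rlcm : M → M → M
  ldvd_rlcm_left : ∀ a b, LDvd a (rlcm a b)
  ldvd_rlcm_right : ∀ a b, LDvd b (rlcm a b)
  rlcm_least : ∀ a b m, LDvd a m → LDvd b m → LDvd (rlcm a b) m
  /-- right-gcd : gcd for the right-divisibility order -/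
  rgcd : M → M → M
  rgcd_dvd_left : ∀ a b, RDvd (rgcd a b) a
  rgcd_dvd_right : ∀ a b, RDvd (rgcd a b) b
  rgcd_greatest : ∀ a b d, RDvd d a → RDvd d b → RDvd d (rgcd a b)
  /-- left-lcm : lcm for the right-divisibility order -/
  llcm : M → M → M
  rdvd_llcm_left : ∀ a b, RDvd a (llcm a b)
  rdvd_llcm_right : ∀ a b, RDvd b (llcm a b)
  llcm_least : ∀ a b m, RDvd a m → RDvd b m → RDvd (llcm a b) m
  /-- Noetherian: no infinite sequence where each term is a proper factor
  of the previous one. -/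
  noetherian : WellFounded (fun a b : M => IsFactor a b ∧ a ≠ b)
  /-- the Garside element -/
  Δ : M
  /-- the left- and right-divisors of `Δ` coincide -/
  delta_balanced : ∀ a : M, LDvd a Δ ↔ RDvd a Δ
  /-- the divisors of `Δ` generate `M` -/
  delta_generates : Submonoid.closure {a : M | LDvd a Δ} = ⊤

variable [CancelMonoid M]

/-- An atom: an element with no proper nontrivial divisor (factor). -/
def IsAtom' (a : M) : Prop := a ≠ 1 ∧ ∀ b : M, IsFactor b a → b = 1 ∨ b = a

/-- A standard parabolic submonoid: a submonoid closed under factors in which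
every element of `M` has a maximal left-divisor (the left `P`-head) and a
maximal right-divisor (the right `P`-head) lying in `P`. -/
structure IsStdParabolic (P : Submonoid M) : Prop where
  factor_closed : ∀ a b : M, b ∈ P → IsFactor a b → a ∈ P
  exists_left_head : ∀ g : M, ∃ h, h ∈ P ∧ LDvd h g ∧
    ∀ h', h' ∈ P → LDvd h' g → LDvd h' h
  exists_right_head : ∀ g : M, ∃ h, h ∈ P ∧ RDvd h g ∧
    ∀ h', h' ∈ P → RDvd h' g → RDvd h' h

/-- `h` is the left `P`-head `H_P g` of `g` : the maximal left-divisor of `g`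
lying in `P`. -/
def IsLeftHead (P : Set M) (g h : M) : Prop :=
  h ∈ P ∧ LDvd h g ∧ ∀ h', h' ∈ P → LDvd h' g → LDvd h' h

/-- `h` is the right `P`-head of `g` : the maximal right-divisor of `g`
lying in `P`. -/
def IsRightHead (P : Set M) (g h : M) : Prop :=
  h ∈ P ∧ RDvd h g ∧ ∀ h', h' ∈ P → RDvd h' g → RDvd h' h

/-- `g` is `P`-reduced : `H_P g = 1`, i.e. the only left-divisor of `g`
lying in `P` is `1`. -/
def PReduced (P : Set M) (g : M) : Prop := ∀ h ∈ P, LDvd h g → h = 1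

/-- `P ^ g` is defined: `p ^ g` is defined (`g ≼ p * g`) for every `p ∈ P`. -/
def ConjSetDef (P : Set M) (g : M) : Prop := ∀ p ∈ P, LDvd g (p * g)

/-- The set `P ^ g = { p ^ g : p ∈ P }`, where `p ^ g` is the unique `c`
with `p * g = g * c`. -/
def conjSet (P : Set M) (g : M) : Set M := {c : M | ∃ p ∈ P, p * g = g * c}

/-- A `P`-ribbon: a `P`-reduced element `g` such that `P ^ g` is defined. -/
def IsRibbon (P : Set M) (g : M) : Prop := PReduced P g ∧ ConjSetDef P g

/-- `P` is the smallest standard parabolic submonoid containing `S₁`. -/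
def IsSmallestParabolicContaining (S₁ : Set M) (P : Submonoid M) : Prop :=
  IsStdParabolic P ∧ S₁ ⊆ (P : Set M) ∧
    ∀ Q : Submonoid M, IsStdParabolic Q → S₁ ⊆ (Q : Set M) → P ≤ Q

/-- Assumption 1: for any set `S₁` of atoms, the right-lcm of `S₁` is the
Garside element `Δ_{P₁} = H_{P₁}(Δ)` of the smallest standard parabolic
submonoid `P₁` containing `S₁`. -/
def Assumption1 (G : GarsideStruct M) : Prop :=
  ∀ S₁ : Set M, (∀ s ∈ S₁, IsAtom' s) →
    ∀ P₁ : Submonoid M, IsSmallestParabolicContaining S₁ P₁ →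
      ∀ d : M, IsLeftHead (P₁ : Set M) G.Δ d →
        (∀ s ∈ S₁, LDvd s d) ∧ ∀ m : M, (∀ s ∈ S₁, LDvd s m) → LDvd d m

/-- Assumption 2: some (positive) power of `Δ` is central. -/
def Assumption2 (G : GarsideStruct M) : Prop :=
  ∃ n : ℕ, 0 < n ∧ ∀ x : M, G.Δ ^ n * x = x * G.Δ ^ n

/-- `v = v_{s,P}` : the element defined by `Δ_{P_s} = Δ_P * v`, where `P_s`
is the smallest standard parabolic submonoid containing `P` and `s`. -/
def IsVsp (G : GarsideStruct M) (P : Submonoid M) (s v : M) : Prop :=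
  ∃ Ps : Submonoid M, IsSmallestParabolicContaining ((P : Set M) ∪ {s}) Ps ∧
    ∃ dP dPs : M, IsLeftHead (P : Set M) G.Δ dP ∧
      IsLeftHead (Ps : Set M) G.Δ dPs ∧ dPs = dP * v

namespace LDvd

theorem trans {a b c : M} (hab : LDvd a b) (hbc : LDvd b c) : LDvd a c := by
  obtain ⟨x, rfl⟩ := hab
  obtain ⟨y, rfl⟩ := hbc
  exact ⟨x * y, mul_assoc _ _ _⟩

theorem mul_left {a b : M} (c : M) (h : LDvd a b) : LDvd (c * a) (c * b) := by
  obtain ⟨x, rfl⟩ := h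
  exact ⟨x, (mul_assoc _ _ _).symm⟩

theorem of_mul_left {a b c : M} (h : LDvd (c * a) (c * b)) : LDvd a b := by
  obtain ⟨x, hx⟩ := h
  exact ⟨x, mul_left_cancel (hx.trans (mul_assoc _ _ _))⟩

end LDvd

namespace GarsideStruct

theorem delta_ldvd_mul_delta (G : GarsideStruct M) (a : M) : LDvd G.Δ (a * G.Δ) := by
  have ha : a ∈ Submonoid.closure {a : M | LDvd a G.Δ} := by
    rw [G.delta_generates]
    trivial
  induction ha using Submonoid.closure_induction with
  | mem a ha =>
    obtain ⟨b, hb⟩ := ha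
    obtain ⟨c, hc⟩ := (G.delta_balanced b).2 ⟨a, hb⟩
    refine ⟨c, ?_⟩
    conv_lhs => rw [hc]
    rw [← mul_assoc, ← hb]
  | one => exact ⟨1, by simp⟩
  | mul a b _ _ iha ihb =>
    obtain ⟨c, hc⟩ := ihb
    refine iha.trans ⟨c, ?_⟩
    rw [mul_assoc, hc, mul_assoc]

theorem ldvd_mul_lgcd_delta (G : GarsideStruct M) {x a b : M} (hx : LDvd x G.Δ)
    (hab : LDvd x (a * b)) : LDvd x (a * G.lgcd b G.Δ) := by
  obtain ⟨y, hy⟩ := G.ldvd_rlcm_left a x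
  have hyb : LDvd y b := by
    have h := G.rlcm_least a x (a * b) ⟨b, rfl⟩ hab
    rw [hy] at h
    exact h.of_mul_left
  have hyΔ : LDvd y G.Δ := by
    have h := G.rlcm_least a x (a * G.Δ) ⟨G.Δ, rfl⟩ (hx.trans (G.delta_ldvd_mul_delta a))
    rw [hy] at h
    exact h.of_mul_left
  have hxy : LDvd x (a * y) := hy ▸ G.ldvd_rlcm_right a x
  exact hxy.trans ((G.lgcd_greatest b G.Δ y hyb hyΔ).mul_left a)

end GarsideStruct

namespace IsRibbon

theorem lgcd_delta (G : GarsideStruct M) {P : Set M} {g : M} (hg : IsRibbon P g) :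
    IsRibbon P (G.lgcd g G.Δ) :=
  ⟨fun h hP hh => hg.1 h hP (hh.trans (G.lgcd_dvd_left g G.Δ)),
    fun p hp => G.ldvd_mul_lgcd_delta (G.lgcd_dvd_right g G.Δ)
      ((G.lgcd_dvd_left g G.Δ).trans (hg.2 p hp))⟩

theorem of_mul {P : Set M} {h t : M} (hg : IsRibbon P (h * t)) :
    IsRibbon (conjSet P h) t := by
  constructor
  · rintro c ⟨p, hp, hpc⟩ hct
    have hph : LDvd p (h * t) := LDvd.trans ⟨h, hpc.symm⟩ (hct.mul_left h)
    have hp1 : p = 1 := hg.1 p hp hph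
    subst hp1
    simpa using hpc
  · rintro c ⟨p, hp, hpc⟩
    have h1 := hg.2 p hp
    rw [← mul_assoc, hpc, mul_assoc] at h1
    exact h1.of_mul_left

end IsRibbon

/-- if `g` is a `P`-ribbon, then `H(g) = leftgcd(g, Δ)` is a
`P`-ribbon and `T(g)` (defined by `g = H(g) * T(g)`) is a `P^{H(g)}`-ribbon;
consequently all terms of the Garside normal form of `g` (obtained by
iterating `H` and `T`) are ribbons for the successive conjugates of `P`. -/
theorem statement10 (G : GarsideStruct M) (hA : Assumption1 G)
    (P : Submonoid M) (hP : IsStdParabolic P)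
    (g : M) (hg : IsRibbon (P : Set M) g) :
    IsRibbon (P : Set M) (G.lgcd g G.Δ) ∧
    (∀ t : M, g = G.lgcd g G.Δ * t →
      IsRibbon (conjSet (P : Set M) (G.lgcd g G.Δ)) t) ∧
    (∀ (n : ℕ) (t rem : ℕ → M) (Q : ℕ → Set M),
      rem n = 1 →
      (∀ i, i < n → rem i = t i * rem (i + 1)) →
      (∀ i, i < n → t i = G.lgcd (rem i) G.Δ) →
      g = rem 0 →
      Q 0 = (P : Set M) →
      (∀ i, i < n → Q (i + 1) = conjSet (Q i) (t i)) →
      ∀ i, i < n → IsRibbon (Q i) (t i)) := by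
  refine ⟨hg.lgcd_delta G, fun t ht => IsRibbon.of_mul (ht ▸ hg), ?_⟩
  intro n t rem Q _ hrem ht hg0 hQ0 hQ
  have hribbon : ∀ i, i ≤ n → IsRibbon (Q i) (rem i) := by
    intro i
    induction i with
    | zero => exact fun _ => hQ0 ▸ hg0 ▸ hg
    | succ i ih =>
      intro hi
      rw [hQ i hi]
      exact IsRibbon.of_mul (hrem i hi ▸ ih (Nat.le_of_lt hi))
  intro i hi
  rw [ht i hi]
  exact (hribbon i hi.le).lgcd_delta G

end GarsidePaper
end

section
/- Let P be a standard parabolic submonoid of M and let g, g' be two P-ribbons. Then leftgcd(g, g') is a P-ribbon. -/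
/-!
Common setting: Garside monoids, standard parabolic submonoids, heads,
ribbons, following Digne–Michel, "Ribbons in Garside monoids".
-/

namespace GarsidePaper

variable {M : Type*}

variable [CancelMonoid M]

/-- `p * lgcd a b` is a greatest common left-divisor of `p * a` and `p * b`. -/
theorem GarsideStruct.ldvd_mul_lgcd (G : GarsideStruct M) {a b d p : M}
    (ha : LDvd d (p * a)) (hb : LDvd d (p * b)) : LDvd d (p * G.lgcd a b) := by
  obtain ⟨x, hx⟩ := G.lgcd_greatest (p * a) (p * b) p ⟨a, rfl⟩ ⟨b, rfl⟩
  obtain ⟨u, hu⟩ := G.lgcd_dvd_left (p * a) (p * b)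
  obtain ⟨v, hv⟩ := G.lgcd_dvd_right (p * a) (p * b)
  rw [hx, mul_assoc] at hu hv
  obtain ⟨w, hw⟩ := G.lgcd_greatest a b x ⟨u, mul_left_cancel hu⟩ ⟨v, mul_left_cancel hv⟩
  obtain ⟨z, hz⟩ := G.lgcd_greatest _ _ d ha hb
  exact ⟨z * w, by rw [hw, ← mul_assoc, ← hx, hz, mul_assoc]⟩

theorem LDvd.trans_s11 {a b c : M} (hab : LDvd a b) (hbc : LDvd b c) : LDvd a c := by
  obtain ⟨x, rfl⟩ := hab
  obtain ⟨y, rfl⟩ := hbc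
  exact ⟨x * y, mul_assoc _ _ _⟩

/-- if `g` and `g'` are `P`-ribbons, so is `leftgcd(g, g')`. -/
theorem statement11 (G : GarsideStruct M)
    (P : Submonoid M) (hP : IsStdParabolic P)
    (g g' : M) (hg : IsRibbon (P : Set M) g) (hg' : IsRibbon (P : Set M) g') :
    IsRibbon (P : Set M) (G.lgcd g g') := by
  have hl := G.lgcd_dvd_left g g'
  have hr := G.lgcd_dvd_right g g'
  exact ⟨fun h hh hd => hg.1 h hh (hd.trans_s11 hl), fun p hp =>
    G.ldvd_mul_lgcd (hl.trans_s11 (hg.2 p hp)) (hr.trans_s11 (hg'.2 p hp))⟩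

end GarsidePaper
end

section
/- Let P be a standard parabolic submonoid of M, let G be the group of fractions of M and G_P the subgroup of G generated by (the image of) P. Let b ∈ G_P and g ∈ M be such that b^g = g⁻¹ b g lies in M (identifying M with its image in G). Then (the conjugate) b^{H_P(g)} = H_P(g)⁻¹ b H_P(g) lies in P. -/
/-!
Common setting: Garside monoids, standard parabolic submonoids, heads,
ribbons, following Digne–Michel, "Ribbons in Garside monoids".
-/

namespace GarsidePaper

variable {M : Type*}

variable [CancelMonoid M]

/-- A Garside monoid has no nontrivial invertible element. -/
theorem GarsideStruct.eq_one_of_mul_eq_one (G : GarsideStruct M) {r d : M} (h : r * d = 1) :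
    r = 1 := by
  by_contra hr
  have h₁ : IsFactor 1 r ∧ (1 : M) ≠ r :=
    ⟨⟨r, ⟨r, (one_mul r).symm⟩, 1, (one_mul r).symm⟩, Ne.symm hr⟩
  have h₂ : IsFactor r 1 ∧ r ≠ 1 := ⟨⟨1, ⟨d, h.symm⟩, 1, (one_mul 1).symm⟩, hr⟩
  exact G.noetherian.asymmetric _ _ h₁ h₂

namespace IsStdParabolic

theorem mem_of_mul_mem_right {P : Submonoid M} (hP : IsStdParabolic P) {a b : M}
    (h : a * b ∈ P) : b ∈ P :=
  hP.factor_closed b (a * b) h ⟨b, ⟨1, (mul_one b).symm⟩, a, rfl⟩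

theorem mem_of_mul_mem_left {P : Submonoid M} (hP : IsStdParabolic P) {a b : M}
    (h : a * b ∈ P) : a ∈ P :=
  hP.factor_closed a (a * b) h ⟨a * b, ⟨b, rfl⟩, 1, (one_mul _).symm⟩

/-- Two elements of a standard parabolic submonoid have a common left-multiple there. -/
theorem exists_common_left_multiple {P : Submonoid M} (hP : IsStdParabolic P)
    (G : GarsideStruct M) {a b : M} (ha : a ∈ P) (hb : b ∈ P) :
    ∃ u ∈ P, ∃ v ∈ P, u * a = v * b := by
  obtain ⟨k, hk, -, hmax⟩ := hP.exists_right_head (G.llcm a b)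
  obtain ⟨u, hu⟩ := hmax a ha (G.rdvd_llcm_left a b)
  obtain ⟨v, hv⟩ := hmax b hb (G.rdvd_llcm_right a b)
  exact ⟨u, hP.mem_of_mul_mem_left (hu ▸ hk), v, hP.mem_of_mul_mem_left (hv ▸ hk),
    hu.symm.trans hv⟩

/-- Every element of the subgroup generated by `P` is a left fraction of elements of `P`. -/
theorem exists_left_fraction {Γ : Type*} [Group Γ] {P : Submonoid M} (hP : IsStdParabolic P)
    (G : GarsideStruct M) (φ : M →* Γ) {x : Γ}
    (hx : x ∈ Subgroup.closure (φ '' (P : Set M))) :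
    ∃ p ∈ P, ∃ q ∈ P, x = (φ p)⁻¹ * φ q := by
  induction hx using Subgroup.closure_induction with
  | mem x hx =>
    obtain ⟨q, hq, rfl⟩ := hx
    exact ⟨1, P.one_mem, q, hq, by simp⟩
  | one => exact ⟨1, P.one_mem, 1, P.one_mem, by simp⟩
  | mul x y _ _ hx hy =>
    obtain ⟨p, hp, q, hq, rfl⟩ := hx
    obtain ⟨p', hp', q', hq', rfl⟩ := hy
    obtain ⟨u, hu, v, hv, huv⟩ := hP.exists_common_left_multiple G hq hp'
    refine ⟨u * p, P.mul_mem hu hp, v * q', P.mul_mem hv hq', ?_⟩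
    have key : φ u * φ q = φ v * φ p' := by rw [← map_mul, huv, map_mul]
    have hswap : φ q * (φ p')⁻¹ = (φ u)⁻¹ * φ v := by
      rw [mul_inv_eq_iff_eq_mul, mul_assoc, ← key, inv_mul_cancel_left]
    calc (φ p)⁻¹ * φ q * ((φ p')⁻¹ * φ q')
        = (φ p)⁻¹ * (φ q * (φ p')⁻¹) * φ q' := by group
      _ = (φ (u * p))⁻¹ * φ (v * q') := by rw [hswap, map_mul, map_mul]; group
  | inv x _ hx =>
    obtain ⟨p, hp, q, hq, rfl⟩ := hx
    exact ⟨q, hq, p, hp, by group⟩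

/-- Multiplying an element `q` of `P` on the right by a `P`-reduced element adds no
left-divisor in `P`. -/
theorem ldvd_of_ldvd_mul {P : Submonoid M} (hP : IsStdParabolic P) {p q t : M}
    (hp : p ∈ P) (hq : q ∈ P) (ht : PReduced (P : Set M) t) (h : LDvd p (q * t)) :
    LDvd p q := by
  obtain ⟨k, hk, ⟨c, hc⟩, hmax⟩ := hP.exists_left_head (q * t)
  obtain ⟨r, rfl⟩ := hmax q hq ⟨t, rfl⟩
  have hr : r = 1 := ht r (hP.mem_of_mul_mem_right hk)
    ⟨c, mul_left_cancel (hc.trans (mul_assoc q r c))⟩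
  simpa [hr] using hmax p hp h

end IsStdParabolic

/-- The tail of `g` with respect to its left `P`-head is `P`-reduced. -/
theorem IsLeftHead.pReduced_tail (G : GarsideStruct M) {P : Submonoid M} {h t : M}
    (hh : IsLeftHead (P : Set M) (h * t) h) : PReduced (P : Set M) t := by
  rintro r hr ⟨c, rfl⟩
  obtain ⟨d, hd⟩ := hh.2.2 (h * r) (P.mul_mem hh.1 hr) ⟨c, (mul_assoc h r c).symm⟩
  have hrd : r * d = 1 := mul_left_cancel (a := h) (by rw [← mul_assoc, ← hd, mul_one])
  exact G.eq_one_of_mul_eq_one hrd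

/-- let `Γ` be the group of fractions of `M` (presented by an
injective hom `φ : M →* Γ` such that every element of `Γ` is a left fraction
`(φ p)⁻¹ * φ q`), and `G_P` the subgroup generated by the image of `P`.
If `b ∈ G_P`, `g ∈ M` and `b ^ g = (φ g)⁻¹ * b * φ g` lies in (the image of)
`M`, then `b ^ {H_P(g)}` lies in (the image of) `P`. -/
theorem statement17 {Γ : Type*} [Group Γ] (G : GarsideStruct M)
    (P : Submonoid M) (hP : IsStdParabolic P)
    (φ : M →* Γ) (hinj : Function.Injective φ)
    (hfrac : ∀ x : Γ, ∃ p q : M, x = (φ p)⁻¹ * φ q)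
    (b : Γ) (hb : b ∈ Subgroup.closure (φ '' (P : Set M)))
    (g : M) (hconj : ∃ m : M, (φ g)⁻¹ * b * φ g = φ m)
    (hd : M) (hhd : IsLeftHead (P : Set M) g hd) :
    ∃ p ∈ P, (φ hd)⁻¹ * b * φ hd = φ p := by
  obtain ⟨m, hm⟩ := hconj
  obtain ⟨t, rfl⟩ := hhd.2.1
  have hhdG : φ hd ∈ Subgroup.closure (φ '' (P : Set M)) :=
    Subgroup.subset_closure ⟨hd, hhd.1, rfl⟩
  obtain ⟨p, hp, q, hq, hpq⟩ := hP.exists_left_fraction G φ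
    (mul_mem (mul_mem (inv_mem hhdG) hb) hhdG)
  have hqt : q * t = p * (t * m) := by
    apply hinj
    have hbt : (φ t)⁻¹ * ((φ p)⁻¹ * φ q) * φ t = φ m := by
      rw [← hpq, ← hm, map_mul]
      group
    simp only [map_mul]
    rw [← hbt]
    group
  obtain ⟨r, rfl⟩ := hP.ldvd_of_ldvd_mul hp hq (hhd.pReduced_tail G) ⟨t * m, hqt⟩
  exact ⟨r, hP.mem_of_mul_mem_right hq, by rw [hpq, map_mul, inv_mul_cancel_left]⟩

end GarsidePaper
end
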